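/- arXiv:2312.08024 — 6 statements merged into one kernel-verified Lean document; each statement's English description precedes it below -/
import Mathlib

section
/- For every integer n ≥ 3, every real number m with 0 ≤ m < n+1, and every real number D > 1, the function ȳ ↦ |ȳ|^m (|ȳ|² + D² − 1)^{−n} is integrable on ℝ^{n−1} and ∫_{ℝ^{n−1}} |ȳ|^m (|ȳ|² + D² − 1)^{−n} dȳ = (2π^{(n−1)/2}/Γ((n−1)/2)) · Γ((n−m+1)/2) · Γ((n+m−1)/2) / (2 Γ(n) (D² − 1)^{(n−m+1)/2}). -/
open MeasureTheory Real Set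

lemma integrableOn_rpow_mul_one_sub_rpow {s t : ℝ} (hs : 0 < s) (ht : 0 < t) :
    IntegrableOn (fun u : ℝ => u ^ (s - 1) * (1 - u) ^ (t - 1)) (Ioo 0 1) := by
  have h := Complex.betaIntegral_convergent (u := s) (v := t) (by simpa) (by simpa)
  rw [intervalIntegrable_iff_integrableOn_Ioo_of_le zero_le_one] at h
  refine IntegrableOn.congr_fun (Integrable.re h) (fun u hu => ?_) measurableSet_Ioo
  have h1 : (0 : ℝ) ≤ 1 - u := by linarith [hu.2]
  simp only [RCLike.re_eq_complex_re]
  rw [← Complex.ofReal_re (u ^ (s - 1) * (1 - u) ^ (t - 1)), Complex.ofReal_mul,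
    Complex.ofReal_cpow hu.1.le, Complex.ofReal_cpow h1]
  push_cast
  rfl

/-- Euler's beta integral with real parameters. -/
lemma setIntegral_rpow_mul_one_sub_rpow {s t : ℝ} (hs : 0 < s) (ht : 0 < t) :
    ∫ u in Ioo (0 : ℝ) 1, u ^ (s - 1) * (1 - u) ^ (t - 1) =
      Real.Gamma s * Real.Gamma t / Real.Gamma (s + t) := by
  rw [← ProbabilityTheory.beta, ProbabilityTheory.beta_eq_betaIntegralReal s t hs ht,
    Complex.betaIntegral, intervalIntegral.integral_of_le zero_le_one, integral_Ioc_eq_integral_Ioo,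
    ← Complex.ofReal_re (∫ u in Ioo (0 : ℝ) 1, u ^ (s - 1) * (1 - u) ^ (t - 1)),
    ← integral_complex_ofReal]
  congr 1
  refine setIntegral_congr_fun measurableSet_Ioo (fun u hu => ?_)
  have h1 : (0 : ℝ) ≤ 1 - u := by linarith [hu.2]
  rw [Complex.ofReal_mul, Complex.ofReal_cpow hu.1.le, Complex.ofReal_cpow h1]
  push_cast
  rfl

/-- The beta integral of the second kind, with a scale parameter `c`. -/
lemma integrableOn_and_integral_rpow_mul_add_rpow {s t c : ℝ} (hs : 0 < s) (ht : 0 < t)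
    (hc : 0 < c) :
    IntegrableOn (fun x : ℝ => x ^ (s - 1) * (x + c) ^ (-(s + t))) (Ioi 0) ∧
    ∫ x in Ioi (0 : ℝ), x ^ (s - 1) * (x + c) ^ (-(s + t)) =
      c ^ (-t) * (Real.Gamma s * Real.Gamma t / Real.Gamma (s + t)) := by
  have himage : (fun u : ℝ => c * u / (1 - u)) '' Ioo 0 1 = Ioi 0 := by
    ext x
    constructor
    · rintro ⟨u, hu, rfl⟩
      have h1 : (0 : ℝ) < 1 - u := by linarith [hu.2]
      have h0 := hu.1
      exact mem_Ioi.2 (by positivity)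
    · intro hx
      have hx : 0 < x := hx
      have hxc : 0 < x + c := by positivity
      refine ⟨x / (x + c), ⟨by positivity, by rw [div_lt_one hxc]; linarith⟩, ?_⟩
      have h : 1 - x / (x + c) = c / (x + c) := by field_simp; ring
      simp only [h]
      field_simp
  have hderiv : ∀ u ∈ Ioo (0 : ℝ) 1,
      HasDerivWithinAt (fun u : ℝ => c * u / (1 - u)) (c / (1 - u) ^ 2) (Ioo 0 1) u := by
    intro u hu
    have h1 : 1 - u ≠ 0 := by linarith [hu.2]
    have h := ((hasDerivAt_id u).const_mul c).div ((hasDerivAt_id u).const_sub 1) h1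
    refine (h.congr_deriv ?_).hasDerivWithinAt
    simp only [id]
    congr 1
    ring
  have hinj : InjOn (fun u : ℝ => c * u / (1 - u)) (Ioo 0 1) := by
    intro u hu v hv huv
    have h1 : 1 - u ≠ 0 := by linarith [hu.2]
    have h2 : 1 - v ≠ 0 := by linarith [hv.2]
    simp only [] at huv
    rw [div_eq_div_iff h1 h2] at huv
    have : c * (u - v) = 0 := by linarith
    rcases mul_eq_zero.1 this with h | h <;> linarith
  have hcongr : EqOn (fun u : ℝ => |c / (1 - u) ^ 2| •
      ((c * u / (1 - u)) ^ (s - 1) * (c * u / (1 - u) + c) ^ (-(s + t))))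
      (fun u => c ^ (-t) * (u ^ (s - 1) * (1 - u) ^ (t - 1))) (Ioo 0 1) := by
    intro u hu
    have h1 : (0 : ℝ) < 1 - u := by linarith [hu.2]
    have h0 := hu.1
    have hadd : c * u / (1 - u) + c = c / (1 - u) := by field_simp; ring
    simp only [smul_eq_mul]
    rw [abs_of_pos (by positivity), hadd, div_rpow (by positivity) h1.le,
      mul_rpow hc.le h0.le, div_rpow hc.le h1.le]
    have e1 : c ^ (-t) = c * c ^ (s - 1) * c ^ (-(s + t)) := by
      rw [← rpow_one_add' hc.le (by linarith), ← rpow_add hc]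
      congr 1
      ring
    have e2 : (1 - u) ^ (t - 1) * ((1 - u) ^ 2 * (1 - u) ^ (s - 1) * (1 - u) ^ (-(s + t))) = 1 := by
      rw [← rpow_natCast, ← rpow_add h1, ← rpow_add h1, ← rpow_add h1]
      convert rpow_zero _ using 2
      push_cast
      ring
    rw [e1, eq_div_of_mul_eq (by positivity) e2]
    have p1 := rpow_pos_of_pos h1 (s - 1)
    have p2 := rpow_pos_of_pos h1 (-(s + t))
    field_simp
  constructor
  · rw [← himage, integrableOn_image_iff_integrableOn_abs_deriv_smul measurableSet_Ioo hderiv hinj,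
      integrableOn_congr_fun hcongr measurableSet_Ioo]
    exact (integrableOn_rpow_mul_one_sub_rpow hs ht).const_mul _
  · rw [← himage, integral_image_eq_integral_abs_deriv_smul measurableSet_Ioo hderiv hinj,
      setIntegral_congr_fun measurableSet_Ioo hcongr, integral_const_mul,
      setIntegral_rpow_mul_one_sub_rpow hs ht]

lemma integrableOn_and_integral_rpow_mul_sq_add_rpow {s t c : ℝ} (hs : 0 < s) (ht : 0 < t)
    (hc : 0 < c) :
    IntegrableOn (fun r : ℝ => r ^ (2 * s - 1) * (r ^ 2 + c) ^ (-(s + t))) (Ioi 0) ∧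
    ∫ r in Ioi (0 : ℝ), r ^ (2 * s - 1) * (r ^ 2 + c) ^ (-(s + t)) =
      c ^ (-t) * (Real.Gamma s * Real.Gamma t / Real.Gamma (s + t)) / 2 := by
  obtain ⟨hint, hval⟩ := integrableOn_and_integral_rpow_mul_add_rpow hs ht hc
  have hcongr : EqOn (fun r : ℝ => (|(2 : ℝ)| * r ^ ((2 : ℝ) - 1)) •
      ((r ^ (2 : ℝ)) ^ (s - 1) * (r ^ (2 : ℝ) + c) ^ (-(s + t))))
      (fun r => 2 * (r ^ (2 * s - 1) * (r ^ 2 + c) ^ (-(s + t)))) (Ioi 0) := by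
    intro r hr
    have hr : 0 < r := hr
    simp only [smul_eq_mul]
    have e : r ^ (2 * s - 1) = r ^ ((2 : ℝ) - 1) * (r ^ (2 : ℝ)) ^ (s - 1) := by
      rw [← rpow_mul hr.le, ← rpow_add hr]
      congr 1
      ring
    rw [e, rpow_two, abs_of_pos two_pos]
    ring
  constructor
  · rw [← integrableOn_Ioi_comp_rpow_iff _ two_ne_zero,
      integrableOn_congr_fun hcongr measurableSet_Ioi] at hint
    refine IntegrableOn.congr_fun (hint.const_mul 2⁻¹) (fun r _ => ?_) measurableSet_Ioi
    ring
  · rw [← integral_comp_rpow_Ioi _ two_ne_zero,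
      setIntegral_congr_fun measurableSet_Ioi hcongr, integral_const_mul] at hval
    linarith

theorem stmt_1 (n : ℕ) (hn : 3 ≤ n) (m : ℝ) (hm0 : 0 ≤ m) (hm1 : m < (n:ℝ) + 1)
    (D : ℝ) (hD : 1 < D) :
    Integrable (fun y : EuclideanSpace ℝ (Fin (n-1)) =>
      ‖y‖ ^ m * (‖y‖^2 + D^2 - 1) ^ (-(n:ℝ))) volume ∧
    ∫ y : EuclideanSpace ℝ (Fin (n-1)), ‖y‖ ^ m * (‖y‖^2 + D^2 - 1) ^ (-(n:ℝ))
      = (2 * Real.pi ^ (((n:ℝ) - 1)/2) / Real.Gamma (((n:ℝ) - 1)/2)) *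
        (Real.Gamma (((n:ℝ) - m + 1)/2) * Real.Gamma (((n:ℝ) + m - 1)/2)
          / (2 * Real.Gamma n * (D^2 - 1) ^ (((n:ℝ) - m + 1)/2))) := by
  have hn' : (3 : ℝ) ≤ n := by exact_mod_cast hn
  have hc : 0 < D ^ 2 - 1 := by nlinarith
  obtain ⟨hint, hval⟩ := integrableOn_and_integral_rpow_mul_sq_add_rpow
    (s := ((n : ℝ) + m - 1) / 2) (t := ((n : ℝ) - m + 1) / 2) (by linarith) (by linarith) hc
  have hst : ((n : ℝ) + m - 1) / 2 + ((n : ℝ) - m + 1) / 2 = n := by ring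
  rw [hst] at hint hval
  have : Nonempty (Fin (n - 1)) := ⟨⟨0, by omega⟩⟩
  have hnc : ((n - 1 : ℕ) : ℝ) = n - 1 := by rw [Nat.cast_sub (by omega)]; simp
  have hcongr : EqOn (fun r : ℝ => r ^ (n - 1 - 1) • (r ^ m * (r ^ 2 + D ^ 2 - 1) ^ (-(n : ℝ))))
      (fun r => r ^ (2 * (((n : ℝ) + m - 1) / 2) - 1) * (r ^ 2 + (D ^ 2 - 1)) ^ (-(n : ℝ)))
      (Ioi 0) := by
    intro r hr
    have hr : 0 < r := hr
    simp only [smul_eq_mul]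
    rw [← mul_assoc, ← rpow_natCast, ← rpow_add hr, Nat.cast_sub (by omega), hnc, add_sub_assoc]
    congr 2
    push_cast
    ring
  constructor
  · rw [integrable_fun_norm_addHaar volume
      (f := fun r : ℝ => r ^ m * (r ^ 2 + D ^ 2 - 1) ^ (-(n : ℝ))), finrank_euclideanSpace_fin,
      integrableOn_congr_fun hcongr measurableSet_Ioi]
    exact hint
  · have hpos : 0 < ((n : ℝ) - 1) / 2 := by linarith
    have hG : 0 < Real.Gamma (((n : ℝ) - 1) / 2) := Real.Gamma_pos_of_pos hpos
    have hsqrt : √π ^ (n - 1) = π ^ (((n : ℝ) - 1) / 2) := by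
      rw [sqrt_eq_rpow, ← rpow_natCast, ← rpow_mul pi_pos.le, hnc]
      congr 1
      ring
    have hball : volume.real (Metric.ball (0 : EuclideanSpace ℝ (Fin (n - 1))) 1) =
        π ^ (((n : ℝ) - 1) / 2) / ((((n : ℝ) - 1) / 2) * Real.Gamma (((n : ℝ) - 1) / 2)) := by
      rw [measureReal_def, EuclideanSpace.volume_ball, Fintype.card_fin, hnc, hsqrt,
        Real.Gamma_add_one hpos.ne', ENNReal.ofReal_one, one_pow, one_mul,
        ENNReal.toReal_ofReal (by positivity)]
    rw [integral_fun_norm_addHaar volume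
      (fun r : ℝ => r ^ m * (r ^ 2 + D ^ 2 - 1) ^ (-(n : ℝ))), finrank_euclideanSpace_fin,
      setIntegral_congr_fun measurableSet_Ioi hcongr, hval, hball, nsmul_eq_mul, smul_eq_mul, hnc,
      rpow_neg hc.le]
    have hn1 : (n : ℝ) - 1 ≠ 0 := by linarith
    have hGn : Real.Gamma n ≠ 0 := (Real.Gamma_pos_of_pos (by linarith)).ne'
    have hp : (D ^ 2 - 1) ^ (((n : ℝ) - m + 1) / 2) ≠ 0 := (rpow_pos_of_pos hc _).ne'
    have hG' := hG.ne'
    field_simp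
end

section
/- Let n ≥ 3 be an integer, D > 1, and fix i ∈ {1, …, n−1}. Define 𝔍_i(x) = α_n (2−n) x_i (|x̄|² + (x_n + D)² − 1)^{−n/2} for x = (x̄, x_n) with x_n ≥ 0. Then 𝔍_i is smooth on the closed half-space {x_n ≥ 0}, it satisfies the linearized equation −(4(n−1)/(n−2)) Δ 𝔍_i(x) + ((n+2)/(n−2)) U₁(x)^{4/(n−2)} 𝔍_i(x) = 0 for every x with x_n > 0, and the linearized boundary condition (2/(n−2)) · (−∂𝔍_i/∂x_n)(x̄, 0) − (D/(n−2)) √(n/(n−1)) · U₁(x̄, 0)^{2/(n−2)} 𝔍_i(x̄, 0) = 0 for every x̄ ∈ ℝ^{n−1}. -/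
open MeasureTheory Real Set

noncomputable section

/-- `α_n = (4n(n-1))^((n-2)/4)`. -/
def alphaN (n : ℕ) : ℝ := (4*(n:ℝ)*((n:ℝ)-1)) ^ (((n:ℝ)-2)/4)

/-- The bubble `U_{δ,ξ}` on the half-space, points written as `(x̄, xₙ)`. -/
def bubble (n : ℕ) (D δ : ℝ) (ξ : EuclideanSpace ℝ (Fin (n-1)))
    (x : EuclideanSpace ℝ (Fin (n-1)) × ℝ) : ℝ :=
  alphaN n * δ ^ (((n:ℝ)-2)/2) /
    (‖x.1 - ξ‖^2 + (x.2 + δ*D)^2 - δ^2) ^ (((n:ℝ)-2)/2)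

/-- Euclidean Laplacian `Δu = Σᵢ ∂²u/∂xᵢ² + ∂²u/∂xₙ²` on `ℝ^{n-1} × ℝ`. -/
def lapl {m : ℕ} (u : EuclideanSpace ℝ (Fin m) × ℝ → ℝ)
    (x : EuclideanSpace ℝ (Fin m) × ℝ) : ℝ :=
  (∑ i : Fin m, fderiv ℝ (fun y => fderiv ℝ u y (EuclideanSpace.single i 1, 0)) x
      (EuclideanSpace.single i 1, 0))
  + fderiv ℝ (fun y => fderiv ℝ u y ((0 : EuclideanSpace ℝ (Fin m)), (1:ℝ))) x
      ((0 : EuclideanSpace ℝ (Fin m)), (1:ℝ))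

/-- The function `𝔍_i(x) = α_n (2-n) x_i (|x̄|² + (xₙ + D)² - 1)^{-n/2}`, for
`i ∈ {1,…,n-1}`. -/
def frakJ (n : ℕ) (D : ℝ) (i : Fin (n-1))
    (x : EuclideanSpace ℝ (Fin (n-1)) × ℝ) : ℝ :=
  alphaN n * (2 - (n:ℝ)) * x.1 i * (‖x.1‖^2 + (x.2 + D)^2 - 1) ^ (-(n:ℝ)/2)

/-- The shifted quadratic form `|x̄|² + (xₙ + D)² - 1` underlying the bubble. -/
def shiftedQuad {m : ℕ} (D : ℝ) (x : EuclideanSpace ℝ (Fin m) × ℝ) : ℝ :=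
  ‖x.1‖ ^ 2 + (x.2 + D) ^ 2 - 1

/-- Half the derivative of `shiftedQuad D` at `x`. -/
def shiftedInner {m : ℕ} (D : ℝ) (x : EuclideanSpace ℝ (Fin m) × ℝ) :
    EuclideanSpace ℝ (Fin m) × ℝ →L[ℝ] ℝ :=
  (innerSL ℝ x.1).comp (ContinuousLinearMap.fst ℝ _ _) +
    (x.2 + D) • ContinuousLinearMap.snd ℝ _ _

/-- The `i`-th horizontal coordinate as a continuous linear functional. -/
def horizontalCoord {m : ℕ} (i : Fin m) : EuclideanSpace ℝ (Fin m) × ℝ →L[ℝ] ℝ :=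
  (EuclideanSpace.proj i).comp (ContinuousLinearMap.fst ℝ _ _)

section

variable {m : ℕ} {D : ℝ} {x : EuclideanSpace ℝ (Fin m) × ℝ}

lemma shiftedInner_apply (e : EuclideanSpace ℝ (Fin m) × ℝ) :
    shiftedInner D x e = inner ℝ x.1 e.1 + (x.2 + D) * e.2 := by
  simp [shiftedInner]

lemma horizontalCoord_apply (i : Fin m) : horizontalCoord i x = x.1 i := by
  simp [horizontalCoord]

lemma shiftedQuad_pos (hD : 1 < D) (hx : 0 ≤ x.2) : 0 < shiftedQuad D x := by
  unfold shiftedQuad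
  nlinarith [sq_nonneg ‖x.1‖]

lemma contDiff_shiftedQuad : ContDiff ℝ (⊤ : ℕ∞) (shiftedQuad (m := m) D) := by
  unfold shiftedQuad
  exact ((contDiff_fst.norm_sq ℝ).add ((contDiff_snd.add contDiff_const).pow 2)).sub contDiff_const

lemma hasFDerivAt_shiftedQuad :
    HasFDerivAt (shiftedQuad D) ((2 : ℝ) • shiftedInner D x) x := by
  have h1 := (hasFDerivAt_fst (𝕜 := ℝ) (p := x)).norm_sq
  have h2 := ((hasFDerivAt_snd (𝕜 := ℝ) (p := x)).add_const D).pow 2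
  refine ((h1.add h2).sub_const 1).congr_fderiv ?_
  ext e
  · simp [shiftedInner]
  · simp [shiftedInner, mul_add]

lemma hasFDerivAt_shiftedQuad_rpow (hx : 0 < shiftedQuad D x) (p : ℝ) :
    HasFDerivAt (fun y => shiftedQuad D y ^ p)
      ((p * shiftedQuad D x ^ (p - 1)) • (2 : ℝ) • shiftedInner D x) x :=
  hasFDerivAt_shiftedQuad.rpow_const (Or.inl hx.ne')

lemma hasFDerivAt_shiftedInner_apply (e : EuclideanSpace ℝ (Fin m) × ℝ) :
    HasFDerivAt (fun y => shiftedInner D y e)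
      ((innerSL ℝ e.1).comp (ContinuousLinearMap.fst ℝ _ _) +
        e.2 • ContinuousLinearMap.snd ℝ _ _) x := by
  have h := ((innerSL ℝ e.1).comp (ContinuousLinearMap.fst ℝ _ ℝ) +
    e.2 • ContinuousLinearMap.snd ℝ _ ℝ).hasFDerivAt (x := x)
  refine (h.add_const (e.2 * D)).congr_of_eventuallyEq (.of_forall fun y => ?_)
  simp only [shiftedInner_apply, add_apply, smul_apply, ContinuousLinearMap.comp_apply,
    ContinuousLinearMap.coe_fst', ContinuousLinearMap.coe_snd', innerSL_apply_apply, smul_eq_mul,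
    real_inner_comm y.1 e.1]
  ring

/-- Fréchet derivative of `c x_i (|x̄|² + (xₙ + D)² - 1)^p`. -/
lemma hasFDerivAt_coord_mul_rpow (hx : 0 < shiftedQuad D x) (c p : ℝ) (i : Fin m) :
    HasFDerivAt (fun y => c * horizontalCoord i y * shiftedQuad D y ^ p)
      ((c * horizontalCoord i x) • (p * shiftedQuad D x ^ (p - 1)) • (2 : ℝ) • shiftedInner D x +
        shiftedQuad D x ^ p • c • horizontalCoord i) x :=
  (((horizontalCoord i).hasFDerivAt).const_mul c).mul (hasFDerivAt_shiftedQuad_rpow hx p)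

/-- Second directional derivative of `c x_i (|x̄|² + (xₙ + D)² - 1)^p`. -/
lemma fderiv_fderiv_coord_mul_rpow (hx : 0 < shiftedQuad D x) (c p : ℝ) (i : Fin m)
    (e : EuclideanSpace ℝ (Fin m) × ℝ) :
    fderiv ℝ (fun y => fderiv ℝ
      (fun z => c * horizontalCoord i z * shiftedQuad D z ^ p) y e) x e =
      c * (4 * p * shiftedQuad D x ^ (p - 1) * (horizontalCoord i e * shiftedInner D x e) +
        horizontalCoord i x * (4 * p * (p - 1) * shiftedQuad D x ^ (p - 2) *
          shiftedInner D x e ^ 2 +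
          2 * p * shiftedQuad D x ^ (p - 1) * (‖e.1‖ ^ 2 + e.2 ^ 2))) := by
  have hev : (fun y => fderiv ℝ
      (fun z => c * horizontalCoord i z * shiftedQuad D z ^ p) y e) =ᶠ[nhds x]
      fun y => (2 * c * p) * (horizontalCoord i y * (shiftedQuad D y ^ (p - 1) *
        shiftedInner D y e)) + (c * horizontalCoord i e) * shiftedQuad D y ^ p := by
    filter_upwards [contDiff_shiftedQuad.continuous.continuousAt.eventually (lt_mem_nhds hx)]
      with y hy
    rw [(hasFDerivAt_coord_mul_rpow hy c p i).fderiv]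
    simp only [add_apply, smul_apply, smul_eq_mul]
    ring
  have h := ((((horizontalCoord i).hasFDerivAt (x := x)).mul
    ((hasFDerivAt_shiftedQuad_rpow hx (p - 1)).mul
      (hasFDerivAt_shiftedInner_apply (D := D) e))).const_mul (2 * c * p)).add
    ((hasFDerivAt_shiftedQuad_rpow hx p).const_mul (c * horizontalCoord i e))
  rw [hev.fderiv_eq]
  refine (congrArg (fun L => L e) h.fderiv).trans ?_
  simp only [add_apply, smul_apply, smul_eq_mul, ContinuousLinearMap.comp_apply, Pi.mul_apply,
    ContinuousLinearMap.coe_fst', ContinuousLinearMap.coe_snd', innerSL_apply_apply,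
    real_inner_self_eq_norm_sq, show p - 1 - 1 = p - 2 by ring]
  ring

/-- At the exponent `p = -(m + 1)/2` the Laplacian collapses to a single power. -/
lemma lapl_coord_mul_rpow (hx : 0 < shiftedQuad D x) (c : ℝ) (i : Fin m) {p : ℝ}
    (hp : 2 * p = -((m : ℝ) + 1)) :
    lapl (fun y => c * horizontalCoord i y * shiftedQuad D y ^ p) x =
      4 * p * (p - 1) * (c * horizontalCoord i x * shiftedQuad D x ^ (p - 2)) := by
  have hpow : shiftedQuad D x ^ (p - 1) = shiftedQuad D x ^ (p - 2) * shiftedQuad D x := by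
    rw [← rpow_add_one hx.ne']
    ring_nf
  have hnorm : ‖x.1‖ ^ 2 = ∑ j, x.1 j ^ 2 := by
    simp [EuclideanSpace.norm_sq_eq]
  have hcoord : ∑ j, horizontalCoord i (EuclideanSpace.single j (1 : ℝ), (0 : ℝ)) * x.1 j
      = x.1 i := by
    simp [horizontalCoord_apply]
  have hquad : ∑ j, x.1 j ^ 2 + (x.2 + D) ^ 2 = shiftedQuad D x + 1 := by
    rw [← hnorm, shiftedQuad]
    ring
  have hinner (j : Fin m) :
      shiftedInner D x (EuclideanSpace.single j (1 : ℝ), (0 : ℝ)) = x.1 j := by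
    simp [shiftedInner_apply, EuclideanSpace.inner_single_right]
  have hvert : shiftedInner D x ((0 : EuclideanSpace ℝ (Fin m)), (1 : ℝ)) = x.2 + D := by
    simp [shiftedInner_apply]
  have hvert' : horizontalCoord i ((0 : EuclideanSpace ℝ (Fin m)), (1 : ℝ)) = 0 := by
    simp [horizontalCoord_apply]
  unfold lapl
  simp only [fderiv_fderiv_coord_mul_rpow hx, hinner, hvert, hvert']
  simp only [← Finset.mul_sum, Finset.sum_add_distrib, hcoord]
  simp only [PiLp.norm_single, norm_zero, norm_one, Finset.sum_const, Finset.card_univ,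
    Fintype.card_fin, nsmul_eq_mul, horizontalCoord_apply, hpow]
  have hm : (m : ℝ) = -(2 * p) - 1 := by linarith
  rw [hm]
  linear_combination (4 * c * x.1 i * p * (p - 1) * shiftedQuad D x ^ (p - 2)) * hquad

end

lemma frakJ_eq (n : ℕ) (D : ℝ) (i : Fin (n - 1)) :
    frakJ n D i = fun y => alphaN n * (2 - (n : ℝ)) * horizontalCoord i y *
      shiftedQuad D y ^ (-(n : ℝ) / 2) := by
  ext y
  rw [horizontalCoord_apply]
  rfl

lemma bubble_rpow {n : ℕ} (hn : 3 ≤ n) {D : ℝ} {x : EuclideanSpace ℝ (Fin (n - 1)) × ℝ}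
    (hx : 0 < shiftedQuad D x) (k : ℝ) :
    bubble n D 1 0 x ^ (k / ((n : ℝ) - 2)) =
      (4 * (n : ℝ) * ((n : ℝ) - 1)) ^ (k / 4) / shiftedQuad D x ^ (k / 2) := by
  have hn' : (3 : ℝ) ≤ n := by exact_mod_cast hn
  have hA : 0 ≤ 4 * (n : ℝ) * ((n : ℝ) - 1) := by nlinarith
  have hn2 : (n : ℝ) - 2 ≠ 0 := by linarith
  have hb : bubble n D 1 0 x = (4 * (n : ℝ) * ((n : ℝ) - 1)) ^ (((n : ℝ) - 2) / 4) /
      shiftedQuad D x ^ (((n : ℝ) - 2) / 2) := by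
    simp [bubble, alphaN, shiftedQuad]
  rw [hb, div_rpow (rpow_nonneg hA _) (rpow_nonneg hx.le _), ← rpow_mul hA, ← rpow_mul hx.le]
  congr 2 <;> field_simp

theorem stmt_3 (n : ℕ) (hn : 3 ≤ n) (D : ℝ) (hD : 1 < D) (i : Fin (n-1)) :
    ContDiffOn ℝ (⊤ : ℕ∞) (frakJ n D i) {x : EuclideanSpace ℝ (Fin (n-1)) × ℝ | 0 ≤ x.2} ∧
    (∀ x : EuclideanSpace ℝ (Fin (n-1)) × ℝ, 0 < x.2 →
      -(4*((n:ℝ)-1)/((n:ℝ)-2)) * lapl (frakJ n D i) x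
        + (((n:ℝ)+2)/((n:ℝ)-2)) * (bubble n D 1 0 x) ^ (4/((n:ℝ)-2)) * frakJ n D i x = 0) ∧
    (∀ xb : EuclideanSpace ℝ (Fin (n-1)),
      (2/((n:ℝ)-2)) * (-(deriv (fun t : ℝ => frakJ n D i (xb, t)) 0))
        - (D/((n:ℝ)-2)) * Real.sqrt ((n:ℝ)/((n:ℝ)-1))
            * (bubble n D 1 0 (xb, 0)) ^ (2/((n:ℝ)-2)) * frakJ n D i (xb, 0) = 0) := by
  have hn' : (3 : ℝ) ≤ n := by exact_mod_cast hn
  have hn2 : (n : ℝ) - 2 ≠ 0 := by linarith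
  rw [frakJ_eq]
  refine ⟨?_, ?_, ?_⟩
  · refine ContDiffOn.mul (contDiff_const.mul (horizontalCoord i).contDiff).contDiffOn ?_
    exact contDiff_shiftedQuad.contDiffOn.rpow_const_of_ne
      fun x hx => (shiftedQuad_pos hD hx).ne'
  · intro x hx
    have hQ := shiftedQuad_pos hD hx.le
    have hm : 2 * (-(n : ℝ) / 2) = -(((n - 1 : ℕ) : ℝ) + 1) := by
      rw [Nat.cast_sub (by omega)]
      push_cast
      ring
    have hpow : shiftedQuad D x ^ (-(n : ℝ) / 2) =
        shiftedQuad D x ^ (-(n : ℝ) / 2 - 2) * shiftedQuad D x ^ (2 : ℝ) := by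
      rw [← rpow_add hQ]
      ring_nf
    have hQ2 : shiftedQuad D x ^ (2 : ℝ) ≠ 0 := (rpow_pos_of_pos hQ _).ne'
    beta_reduce
    rw [lapl_coord_mul_rpow hQ _ i hm, bubble_rpow hn hQ, hpow,
      show (4 : ℝ) / 4 = 1 by norm_num, show (4 : ℝ) / 2 = 2 by norm_num, rpow_one]
    field_simp
    ring
  · intro xb
    have hQ : 0 < shiftedQuad D (xb, (0 : ℝ)) := shiftedQuad_pos hD le_rfl
    have hline : HasDerivAt (fun t : ℝ => (xb, t)) ((0 : EuclideanSpace ℝ (Fin (n - 1))), (1 : ℝ))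
        0 := (hasDerivAt_const _ _).prodMk (hasDerivAt_id _)
    have hder := ((hasFDerivAt_coord_mul_rpow hQ (alphaN n * (2 - (n : ℝ))) (-(n : ℝ) / 2)
      i).comp_hasDerivAt (0 : ℝ) hline).deriv
    have hpow : shiftedQuad D (xb, (0 : ℝ)) ^ (-(n : ℝ) / 2) =
        shiftedQuad D (xb, (0 : ℝ)) ^ (-(n : ℝ) / 2 - 1) * shiftedQuad D (xb, (0 : ℝ)) := by
      rw [← rpow_add_one hQ.ne']
      ring_nf
    have hsqrt : √((n : ℝ) / ((n : ℝ) - 1)) * √(4 * (n : ℝ) * ((n : ℝ) - 1)) = 2 * n := by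
      have hn1 : (n : ℝ) - 1 ≠ 0 := by linarith
      rw [← sqrt_mul (div_nonneg (by linarith) (by linarith)),
        show (n : ℝ) / ((n : ℝ) - 1) * (4 * (n : ℝ) * ((n : ℝ) - 1)) = (2 * n) ^ 2 by
          field_simp
          ring, sqrt_sq (by linarith)]
    refine Eq.trans (congrArg (fun d => 2 / ((n : ℝ) - 2) * (-d) - _) hder) ?_
    beta_reduce
    rw [bubble_rpow hn hQ, hpow, show (2 : ℝ) / 4 = 1 / 2 by norm_num,
      show (2 : ℝ) / 2 = 1 by norm_num, rpow_one, ← sqrt_eq_rpow]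
    simp only [add_apply, smul_apply, smul_eq_mul, shiftedInner_apply, horizontalCoord_apply,
      inner_zero_right, PiLp.zero_apply]
    have hQ0 := hQ.ne'
    generalize shiftedQuad D (xb, (0 : ℝ)) ^ (-(n : ℝ) / 2 - 1) = P
    generalize √((n : ℝ) / ((n : ℝ) - 1)) = a at hsqrt ⊢
    generalize √(4 * (n : ℝ) * ((n : ℝ) - 1)) = b at hsqrt ⊢
    field_simp
    linear_combination (-(D * xb i * alphaN n * (2 - (n : ℝ)) * P)) * hsqrt
end
end

section
/- Let n ≥ 3 be an integer and D > 1. Define 𝔍_n(x) = (α_n (2−n)/2) · (|x̄|² + x_n² + 1 − D²) · (|x̄|² + (x_n + D)² − 1)^{−n/2} for x = (x̄, x_n) with x_n ≥ 0. Then 𝔍_n is smooth on the closed half-space {x_n ≥ 0}, it satisfies the linearized equation −(4(n−1)/(n−2)) Δ 𝔍_n(x) + ((n+2)/(n−2)) U₁(x)^{4/(n−2)} 𝔍_n(x) = 0 for every x with x_n > 0, and the linearized boundary condition (2/(n−2)) · (−∂𝔍_n/∂x_n)(x̄, 0) − (D/(n−2)) √(n/(n−1)) · U₁(x̄, 0)^{2/(n−2)}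 𝔍_n(x̄, 0) = 0 for every x̄ ∈ ℝ^{n−1}. -/
open MeasureTheory Real Set

noncomputable section

/-- The function `𝔍_n(x) = (α_n (2-n)/2)(|x̄|² + xₙ² + 1 - D²)(|x̄|² + (xₙ + D)² - 1)^{-n/2}`. -/
def frakJn (n : ℕ) (D : ℝ) (x : EuclideanSpace ℝ (Fin (n-1)) × ℝ) : ℝ :=
  (alphaN n * (2 - (n:ℝ)) / 2) * (‖x.1‖^2 + x.2^2 + 1 - D^2)
    * (‖x.1‖^2 + (x.2 + D)^2 - 1) ^ (-(n:ℝ)/2)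

/-- Derivative of `y ↦ ‖y.1‖² + (y.2 + b)² + c`. -/
theorem hasFDerivAt_shiftedNormSq {m : ℕ} (b c : ℝ) (y : EuclideanSpace ℝ (Fin m) × ℝ) :
    HasFDerivAt (fun z : EuclideanSpace ℝ (Fin m) × ℝ => ‖z.1‖^2 + (z.2 + b)^2 + c)
      ((2 : ℝ) • ((innerSL ℝ y.1).comp (ContinuousLinearMap.fst ℝ _ ℝ))
        + (2 * (y.2 + b)) • ContinuousLinearMap.snd ℝ _ ℝ) y := by
  have h1 := (hasFDerivAt_fst (𝕜 := ℝ) (p := y)).norm_sq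
  have h2 := ((hasFDerivAt_snd (𝕜 := ℝ) (p := y)).add_const b).pow 2
  refine ((h1.add h2).add_const c).congr_fderiv ?_
  ext v
  · simp
  · simp; ring

/-- Half of the derivative of `y ↦ ‖y.1‖² + (y.2 + b)² + c` in the direction `v`. -/
def halfSlope {m : ℕ} (b : ℝ) (v y : EuclideanSpace ℝ (Fin m) × ℝ) : ℝ :=
  inner ℝ y.1 v.1 + (y.2 + b) * v.2

theorem hasFDerivAt_halfSlope {m : ℕ} (b : ℝ) (v y : EuclideanSpace ℝ (Fin m) × ℝ) :
    HasFDerivAt (halfSlope b v)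
      ((innerSL ℝ v.1).comp (ContinuousLinearMap.fst ℝ _ ℝ)
        + v.2 • ContinuousLinearMap.snd ℝ _ ℝ) y := by
  have h1 := ((innerSL ℝ v.1).comp
    (ContinuousLinearMap.fst ℝ (EuclideanSpace ℝ (Fin m)) ℝ)).hasFDerivAt (x := y)
  have h2 := ((hasFDerivAt_snd (𝕜 := ℝ) (p := y)).add_const b).mul_const v.2
  refine (h1.add h2).congr_of_eventuallyEq (Filter.Eventually.of_forall fun z => ?_)
  simp [halfSlope, real_inner_comm]

/-- The product `k P Q^a` of two shifted squared norms. -/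
def normSqProd {m : ℕ} (k b c b' c' a : ℝ) (y : EuclideanSpace ℝ (Fin m) × ℝ) : ℝ :=
  k * (‖y.1‖^2 + (y.2 + b)^2 + c) * (‖y.1‖^2 + (y.2 + b')^2 + c') ^ a

theorem hasFDerivAt_normSqProd {m : ℕ} (k b c b' c' a : ℝ)
    (y : EuclideanSpace ℝ (Fin m) × ℝ) (hy : 0 < ‖y.1‖^2 + (y.2 + b')^2 + c') :
    ∃ L : EuclideanSpace ℝ (Fin m) × ℝ →L[ℝ] ℝ,
      HasFDerivAt (normSqProd k b c b' c' a) L y ∧ ∀ v, L v =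
      2 * k * (halfSlope b v y * (‖y.1‖^2 + (y.2 + b')^2 + c') ^ a
      + a * (‖y.1‖^2 + (y.2 + b)^2 + c) * halfSlope b' v y
        * (‖y.1‖^2 + (y.2 + b')^2 + c') ^ (a - 1)) := by
  refine ⟨_, ((hasFDerivAt_shiftedNormSq b c y).const_mul k).mul
    ((hasFDerivAt_shiftedNormSq b' c' y).rpow_const (p := a) (Or.inl hy.ne')), fun v => ?_⟩
  simp [halfSlope]
  ring

theorem fderiv_fderiv_normSqProd {m : ℕ} (k b c b' c' a : ℝ)
    (x v : EuclideanSpace ℝ (Fin m) × ℝ) (hx : 0 < ‖x.1‖^2 + (x.2 + b')^2 + c') :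
    fderiv ℝ (fun y => fderiv ℝ (normSqProd k b c b' c' a) y v) x v =
      2 * k * ((‖v.1‖^2 + v.2^2) * (‖x.1‖^2 + (x.2 + b')^2 + c') ^ a
      + a * (4 * halfSlope b v x * halfSlope b' v x
          + (‖x.1‖^2 + (x.2 + b)^2 + c) * (‖v.1‖^2 + v.2^2))
        * (‖x.1‖^2 + (x.2 + b')^2 + c') ^ (a - 1)
      + 2 * a * (a - 1) * (‖x.1‖^2 + (x.2 + b)^2 + c) * halfSlope b' v x ^ 2
        * (‖x.1‖^2 + (x.2 + b')^2 + c') ^ (a - 1 - 1)) := by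
  have hev : ∀ᶠ y : EuclideanSpace ℝ (Fin m) × ℝ in nhds x,
      0 < ‖y.1‖^2 + (y.2 + b')^2 + c' :=
    (hasFDerivAt_shiftedNormSq b' c' x).continuousAt.eventually (lt_mem_nhds hx)
  have heq : (fun y => fderiv ℝ (normSqProd k b c b' c' a) y v) =ᶠ[nhds x] fun y =>
      2 * k * (halfSlope b v y * (‖y.1‖^2 + (y.2 + b')^2 + c') ^ a
      + a * (‖y.1‖^2 + (y.2 + b)^2 + c) * halfSlope b' v y
        * (‖y.1‖^2 + (y.2 + b')^2 + c') ^ (a - 1)) := by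
    filter_upwards [hev] with y hy
    obtain ⟨L, hL, hv⟩ := hasFDerivAt_normSqProd k b c b' c' a y hy
    rw [hL.fderiv, hv]
  have hQ := hasFDerivAt_shiftedNormSq b' c' x
  have h := ((((hasFDerivAt_halfSlope b v x).mul (hQ.rpow_const (p := a) (Or.inl hx.ne'))).add
    ((((hasFDerivAt_shiftedNormSq b c x).const_mul a).mul (hasFDerivAt_halfSlope b' v x)).mul
      (hQ.rpow_const (p := a - 1) (Or.inl hx.ne')))).const_mul (2 * k))
  rw [heq.fderiv_eq]
  refine (congrArg (fun L => L v) h.fderiv).trans ?_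
  simp [halfSlope]
  ring

theorem lapl_normSqProd {m : ℕ} (k b c b' c' a : ℝ)
    (x : EuclideanSpace ℝ (Fin m) × ℝ) (hx : 0 < ‖x.1‖^2 + (x.2 + b')^2 + c') :
    lapl (normSqProd k b c b' c' a) x =
      2 * k * ((m + 1) * (‖x.1‖^2 + (x.2 + b')^2 + c') ^ a
      + a * (4 * (‖x.1‖^2 + (x.2 + b) * (x.2 + b'))
          + (m + 1) * (‖x.1‖^2 + (x.2 + b)^2 + c))
        * (‖x.1‖^2 + (x.2 + b')^2 + c') ^ (a - 1)
      + 2 * a * (a - 1) * (‖x.1‖^2 + (x.2 + b)^2 + c) * (‖x.1‖^2 + (x.2 + b')^2)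
        * (‖x.1‖^2 + (x.2 + b')^2 + c') ^ (a - 1 - 1)) := by
  have hs : ∑ i, x.1 i ^ 2 = ‖x.1‖^2 := (EuclideanSpace.real_norm_sq_eq x.1).symm
  set q := ‖x.1‖^2 + (x.2 + b')^2 + c' with hq
  set p := ‖x.1‖^2 + (x.2 + b)^2 + c with hp
  have hi : ∀ i : Fin m, fderiv ℝ (fun y => fderiv ℝ (normSqProd k b c b' c' a) y
      (EuclideanSpace.single i 1, 0)) x (EuclideanSpace.single i 1, 0) =
      2 * k * (q ^ a + a * p * q ^ (a - 1))
      + 2 * k * (4 * a * q ^ (a - 1) + 2 * a * (a - 1) * p * q ^ (a - 1 - 1)) * x.1 i ^ 2 := by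
    intro i
    rw [fderiv_fderiv_normSqProd k b c b' c' a x _ hx, ← hq, ← hp]
    simp [halfSlope, EuclideanSpace.inner_single_right]
    ring
  rw [lapl, Finset.sum_congr rfl fun i _ => hi i, fderiv_fderiv_normSqProd k b c b' c' a x _ hx,
    Finset.sum_add_distrib, Finset.sum_const, ← Finset.mul_sum, hs, ← hq, ← hp]
  simp [halfSlope]
  ring

theorem frakJn_eq_normSqProd (n : ℕ) (D : ℝ) :
    frakJn n D = normSqProd (alphaN n * (2 - (n:ℝ)) / 2) 0 (1 - D^2) D (-1) (-(n:ℝ)/2) := by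
  funext x
  simp only [frakJn, normSqProd]
  congr 2
  ring

theorem bubble_base_pos {m : ℕ} {D : ℝ} (hD : 1 < D) (x : EuclideanSpace ℝ (Fin m) × ℝ)
    (hx : 0 ≤ x.2) : 0 < ‖x.1‖^2 + (x.2 + D)^2 + -1 := by
  nlinarith [sq_nonneg ‖x.1‖]

theorem bubble_one_rpow (n : ℕ) (hn : 3 ≤ n) {D : ℝ} (hD : 1 < D) (r : ℝ)
    (x : EuclideanSpace ℝ (Fin (n-1)) × ℝ) (hx : 0 ≤ x.2) :
    bubble n D 1 0 x ^ (r / ((n:ℝ)-2)) =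
      (4*(n:ℝ)*((n:ℝ)-1)) ^ (r/4) / (‖x.1‖^2 + (x.2 + D)^2 + -1) ^ (r/2) := by
  have hn' : (3:ℝ) ≤ n := by exact_mod_cast hn
  have hk : (0:ℝ) ≤ 4*(n:ℝ)*((n:ℝ)-1) := mul_nonneg (by linarith) (by linarith)
  have hQ := bubble_base_pos hD x hx
  have h2 : (n:ℝ) - 2 ≠ 0 := by linarith
  have e : ‖x.1 - 0‖^2 + (x.2 + 1*D)^2 - 1^2 = ‖x.1‖^2 + (x.2 + D)^2 + -1 := by
    rw [sub_zero]; ring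
  rw [bubble, e, Real.one_rpow, mul_one, alphaN,
    Real.div_rpow (Real.rpow_nonneg hk _) (Real.rpow_nonneg hQ.le _),
    ← Real.rpow_mul hk, ← Real.rpow_mul hQ.le]
  congr 2 <;> field_simp

theorem stmt_4 (n : ℕ) (hn : 3 ≤ n) (D : ℝ) (hD : 1 < D) :
    ContDiffOn ℝ (⊤ : ℕ∞) (frakJn n D) {x : EuclideanSpace ℝ (Fin (n-1)) × ℝ | 0 ≤ x.2} ∧
    (∀ x : EuclideanSpace ℝ (Fin (n-1)) × ℝ, 0 < x.2 →
      -(4*((n:ℝ)-1)/((n:ℝ)-2)) * lapl (frakJn n D) x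
        + (((n:ℝ)+2)/((n:ℝ)-2)) * (bubble n D 1 0 x) ^ (4/((n:ℝ)-2)) * frakJn n D x = 0) ∧
    (∀ xb : EuclideanSpace ℝ (Fin (n-1)),
      (2/((n:ℝ)-2)) * (-(deriv (fun t : ℝ => frakJn n D (xb, t)) 0))
        - (D/((n:ℝ)-2)) * Real.sqrt ((n:ℝ)/((n:ℝ)-1))
            * (bubble n D 1 0 (xb, 0)) ^ (2/((n:ℝ)-2)) * frakJn n D (xb, 0) = 0) := by
  have hn' : (3:ℝ) ≤ n := by exact_mod_cast hn
  have h2 : (n:ℝ) - 2 ≠ 0 := by linarith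
  have h1 : 0 < (n:ℝ) - 1 := by linarith
  have hm : ((n - 1 : ℕ) : ℝ) = n - 1 := by
    rw [Nat.cast_sub (by omega), Nat.cast_one]
  refine ⟨?_, ?_, ?_⟩
  · intro x hx
    have hQ := bubble_base_pos hD x hx
    rw [frakJn_eq_normSqProd]
    have hs : ∀ b c : ℝ, ContDiffAt ℝ (⊤ : ℕ∞)
        (fun z : EuclideanSpace ℝ (Fin (n-1)) × ℝ => ‖z.1‖^2 + (z.2 + b)^2 + c) x := fun b c =>
      ((contDiffAt_fst.norm_sq ℝ).add ((contDiffAt_snd.add contDiffAt_const).pow 2)).add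
        contDiffAt_const
    exact ((contDiffAt_const.mul (hs _ _)).mul
      ((hs _ _).rpow_const_of_ne hQ.ne')).contDiffWithinAt
  · intro x hx
    have hQ := bubble_base_pos hD x hx.le
    rw [bubble_one_rpow n hn hD 4 x hx.le, frakJn_eq_normSqProd,
      lapl_normSqProd _ _ _ _ _ _ x hQ, hm, normSqProd]
    set q := ‖x.1‖^2 + (x.2 + D)^2 + -1 with hq
    have e1 : q ^ (-(n:ℝ)/2 - 1) = q ^ (-(n:ℝ)/2) / q := Real.rpow_sub_one hQ.ne' _
    have e2 : q ^ (-(n:ℝ)/2 - 1 - 1) = q ^ (-(n:ℝ)/2) / q / q := by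
      rw [Real.rpow_sub_one hQ.ne', e1]
    have e3 : q ^ ((4:ℝ)/2) = q ^ 2 := by
      rw [← Real.rpow_natCast]; norm_num
    rw [e1, e2, e3, div_self four_ne_zero, Real.rpow_one]
    generalize q ^ (-(n:ℝ)/2) = w
    have hN : ‖x.1‖^2 = q + 1 - (x.2 + D)^2 := by rw [hq]; ring
    rw [hN]
    field_simp
    ring
  · intro xb
    have hQ := bubble_base_pos hD (xb, 0) le_rfl
    have hd : HasDerivAt (fun t : ℝ => (xb, t)) ((0 : EuclideanSpace ℝ (Fin (n-1))), (1:ℝ)) 0 :=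
      (hasDerivAt_const _ _).prodMk (hasDerivAt_id _)
    obtain ⟨L, hL, hv⟩ := hasFDerivAt_normSqProd (alphaN n * (2 - (n:ℝ)) / 2) 0 (1 - D^2) D (-1)
      (-(n:ℝ)/2) (xb, (0:ℝ)) hQ
    have hder := hL.comp_hasDerivAt (0:ℝ) hd
    rw [bubble_one_rpow n hn hD 2 (xb, 0) le_rfl, frakJn_eq_normSqProd]
    rw [show deriv (fun t : ℝ => normSqProd (alphaN n * (2 - (n:ℝ)) / 2) 0 (1 - D^2) D (-1)
      (-(n:ℝ)/2) (xb, t)) 0 = _ from hder.deriv, hv, normSqProd]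
    set q := ‖((xb, (0:ℝ)) : EuclideanSpace ℝ (Fin (n-1)) × ℝ).1‖^2
      + (((xb, (0:ℝ)) : EuclideanSpace ℝ (Fin (n-1)) × ℝ).2 + D)^2 + -1 with hq
    have e1 : q ^ (-(n:ℝ)/2 - 1) = q ^ (-(n:ℝ)/2) / q := Real.rpow_sub_one hQ.ne' _
    have e3 : √((n:ℝ)/((n:ℝ)-1)) * (4*(n:ℝ)*((n:ℝ)-1)) ^ ((2:ℝ)/4) = 2 * n := by
      rw [show (2:ℝ)/4 = 1/2 by norm_num, ← Real.sqrt_eq_rpow,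
        ← Real.sqrt_mul (div_nonneg (by linarith) h1.le),
        show (n:ℝ)/((n:ℝ)-1) * (4*(n:ℝ)*((n:ℝ)-1)) = (2 * n)^2 by field_simp; ring,
        Real.sqrt_sq (by linarith)]
    rw [e1, div_self two_ne_zero, Real.rpow_one, mul_assoc (D / _), ← mul_div_assoc (√_), e3]
    generalize q ^ (-(n:ℝ)/2) = w
    simp only [halfSlope, inner_zero_right]
    field_simp
    ring
end
end

section
/- Let n = 6 and D > 1. Then there exists a constant C > 0 such that for every R ≥ 2, ∫_{C(0,R)} U₁(y)^{3/2} dy ≤ C log R. -/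
open MeasureTheory Real Set

noncomputable section

/-- The bubble `U₁` for `n = 6`: `U₁(x) = 120 / (|x̄|² + (x₆ + D)² - 1)²`. -/
def bubble6 (D : ℝ) (x : EuclideanSpace ℝ (Fin 5) × ℝ) : ℝ :=
  120 / (‖x.1‖^2 + (x.2 + D)^2 - 1)^2

/-- On the upper half-space, `U₁ ^ (3/2)` decays at least like the inverse sixth power of the
norm (the sup norm of the product). -/
theorem exists_bubble6_rpow_le (D : ℝ) (hD : 1 < D) :
    ∃ K : ℝ, 0 < K ∧ ∀ y : EuclideanSpace ℝ (Fin 5) × ℝ, 0 < y.2 →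
      (bubble6 D y) ^ ((3:ℝ)/2) ≤ K * ((1 + ‖y‖) ^ 6)⁻¹ := by
  set c : ℝ := min 1 (D ^ 2 - 1) / 2 with hc
  have hc0 : 0 < c := by
    have : 0 < D ^ 2 - 1 := by nlinarith
    positivity
  have hc1 : 2 * c ≤ 1 := by rw [hc]; linarith [min_le_left 1 (D ^ 2 - 1)]
  have hc2 : 2 * c ≤ D ^ 2 - 1 := by rw [hc]; linarith [min_le_right 1 (D ^ 2 - 1)]
  refine ⟨(120 / c ^ 2) ^ ((3:ℝ)/2), by positivity, fun y hy => ?_⟩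
  have hm : ‖y‖ ^ 2 ≤ ‖y.1‖ ^ 2 + y.2 ^ 2 := by
    rw [Prod.norm_def]
    rcases max_choice ‖y.1‖ ‖y.2‖ with h | h <;> rw [h]
    · nlinarith
    · rw [Real.norm_eq_abs, sq_abs]; nlinarith
  have hm0 := norm_nonneg y
  have hQ : c * (1 + ‖y‖) ^ 2 ≤ ‖y.1‖ ^ 2 + (y.2 + D) ^ 2 - 1 := by
    have h1 : c * (1 + ‖y‖) ^ 2 ≤ 2 * c * (1 + ‖y‖ ^ 2) := by
      nlinarith [mul_nonneg hc0.le (sq_nonneg (1 - ‖y‖))]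
    have h2 : 2 * c * ‖y‖ ^ 2 ≤ ‖y‖ ^ 2 := by nlinarith [sq_nonneg ‖y‖]
    nlinarith [mul_pos hy (by linarith : 0 < D)]
  have hb : bubble6 D y ≤ 120 / c ^ 2 * ((1 + ‖y‖)⁻¹) ^ 4 := by
    calc bubble6 D y ≤ 120 / (c * (1 + ‖y‖) ^ 2) ^ 2 := by
          unfold bubble6; gcongr
      _ = _ := by field_simp
  calc (bubble6 D y) ^ ((3:ℝ)/2)
      ≤ (120 / c ^ 2 * ((1 + ‖y‖)⁻¹) ^ 4) ^ ((3:ℝ)/2) := by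
        refine Real.rpow_le_rpow ?_ hb (by norm_num)
        unfold bubble6; positivity
    _ = _ := by
        rw [Real.mul_rpow (by positivity) (by positivity), ← Real.rpow_natCast _ 4,
          ← Real.rpow_mul (by positivity), ← inv_pow, ← Real.rpow_natCast _ 6]
        norm_num

theorem integrableOn_const_mul_one_add_inv (K R : ℝ) :
    IntegrableOn (fun s : ℝ => K * (1 + s)⁻¹) (Ioc 0 R) := by
  refine (ContinuousOn.integrableOn_Icc ?_).mono_set Ioc_subset_Icc_self
  exact continuousOn_const.mul ((continuousOn_const.add continuousOn_id).inv₀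
    fun s hs => (add_pos_of_pos_of_nonneg one_pos hs.1).ne')

theorem setIntegral_one_add_inv {R : ℝ} (hR : 0 ≤ R) :
    ∫ s in Ioc 0 R, (1 + s)⁻¹ = Real.log (1 + R) := by
  rw [← intervalIntegral.integral_of_le hR,
    intervalIntegral.integral_comp_add_left (fun s : ℝ => s⁻¹) 1,
    integral_inv_of_pos (by norm_num) (by positivity)]
  norm_num

theorem stmt_11 (D : ℝ) (hD : 1 < D) :
    ∃ C : ℝ, 0 < C ∧ ∀ R : ℝ, 2 ≤ R →
      (∫ y in {y : EuclideanSpace ℝ (Fin 5) × ℝ | ‖y.1‖ < R ∧ 0 < y.2 ∧ y.2 < R},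
        (bubble6 D y) ^ ((3:ℝ)/2)) ≤ C * Real.log R := by
  obtain ⟨K, hK, hbound⟩ := exists_bubble6_rpow_le D hD
  set v : ℝ := volume.real (Metric.ball (0 : EuclideanSpace ℝ (Fin 5) × ℝ) 1) with hv
  have hv0 : 0 < v := ENNReal.toReal_pos (Metric.measure_ball_pos _ _ one_pos).ne' measure_ball_lt_top.ne
  refine ⟨6 * v * (K * 2), by positivity, fun R hR => ?_⟩
  have : (volume : Measure (EuclideanSpace ℝ (Fin 5) × ℝ)).IsAddHaarMeasure :=
    Measure.prod.instIsAddHaarMeasure volume volume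
  have hdim : Module.finrank ℝ (EuclideanSpace ℝ (Fin 5) × ℝ) = 6 := by simp
  set g : ℝ → ℝ := (Iic R).indicator (fun s => K * ((1 + s) ^ 6)⁻¹) with hg
  have hle : ∀ s ∈ Ioi (0 : ℝ), s ^ 5 * g s ≤ (Ioc 0 R).indicator (fun s => K * (1 + s)⁻¹) s := by
    intro s hs
    have hs : 0 < s := hs
    by_cases h : s ≤ R
    · rw [hg, indicator_of_mem (mem_Iic.2 h), indicator_of_mem (mem_Ioc.2 ⟨hs, h⟩)]
      calc s ^ 5 * (K * ((1 + s) ^ 6)⁻¹) ≤ (1 + s) ^ 5 * (K * ((1 + s) ^ 6)⁻¹) := by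
            gcongr; linarith
        _ = _ := by field_simp
    · rw [hg, indicator_of_notMem (by simpa using h), indicator_of_notMem (by simp [h])]
      simp
  have hnn : ∀ s ∈ Ioi (0 : ℝ), 0 ≤ s ^ 5 * g s := by
    intro s hs
    have hs : 0 < s := hs
    exact mul_nonneg (by positivity) (indicator_apply_nonneg fun _ => by positivity)
  have hint : IntegrableOn ((Ioc 0 R).indicator (fun s => K * (1 + s)⁻¹)) (Ioi (0 : ℝ)) :=
    ((integrableOn_const_mul_one_add_inv K R).integrable_indicator measurableSet_Ioc).integrableOn
  have hgm : Measurable g := Measurable.indicator (by fun_prop) measurableSet_Iic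
  have hgi : Integrable (fun y : EuclideanSpace ℝ (Fin 5) × ℝ => g ‖y‖) := by
    rw [integrable_fun_norm_addHaar, hdim]
    refine hint.mono' (by fun_prop) ?_
    filter_upwards [ae_restrict_mem measurableSet_Ioi] with s hs
    rw [smul_eq_mul, Real.norm_of_nonneg (hnn s hs)]
    exact hle s hs
  have hgint : ∫ s in Ioi (0 : ℝ), s ^ 5 * g s ≤ K * Real.log (1 + R) := by
    calc ∫ s in Ioi (0 : ℝ), s ^ 5 * g s
        ≤ ∫ s in Ioi (0 : ℝ), (Ioc 0 R).indicator (fun s => K * (1 + s)⁻¹) s := by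
          refine integral_mono_of_nonneg ?_ hint ?_
          · filter_upwards [ae_restrict_mem measurableSet_Ioi] with s hs using hnn s hs
          · filter_upwards [ae_restrict_mem measurableSet_Ioi] with s hs using hle s hs
      _ = K * Real.log (1 + R) := by
          rw [setIntegral_indicator measurableSet_Ioc,
            inter_eq_right.2 (fun s hs => hs.1), integral_const_mul,
            setIntegral_one_add_inv (by linarith)]
  have hS : MeasurableSet
      {y : EuclideanSpace ℝ (Fin 5) × ℝ | ‖y.1‖ < R ∧ 0 < y.2 ∧ y.2 < R} := by
    refine IsOpen.measurableSet ?_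
    exact (isOpen_lt continuous_fst.norm continuous_const).inter
      ((isOpen_lt continuous_const continuous_snd).inter
        (isOpen_lt continuous_snd continuous_const))
  have hlog : Real.log (1 + R) ≤ 2 * Real.log R := by
    rw [← Real.log_rpow (by linarith)]
    refine Real.log_le_log (by linarith) ?_
    norm_num
    nlinarith
  rw [← integral_indicator hS]
  refine (integral_mono_of_nonneg (g := fun y => g ‖y‖)
    (ae_of_all _ fun y => ?_) hgi (ae_of_all _ fun y => ?_)).trans ?_
  · refine indicator_apply_nonneg (M := ℝ) fun _ => ?_
    unfold bubble6; positivity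
  · refine indicator_apply_le' (M := ℝ) (fun hy => ?_) (fun _ => ?_)
    · have : ‖y‖ ≤ R := by
        rw [Prod.norm_def, Real.norm_of_nonneg hy.2.1.le]
        exact max_le hy.1.le hy.2.2.le
      simp only [hg, indicator_of_mem (mem_Iic.2 this)]
      exact hbound y hy.2.1
    · exact indicator_apply_nonneg fun _ => by positivity
  · calc ∫ y : EuclideanSpace ℝ (Fin 5) × ℝ, g ‖y‖
        = 6 * v * ∫ s in Ioi (0 : ℝ), s ^ 5 * g s := by
          rw [integral_fun_norm_addHaar, hdim]
          simp [hv, mul_assoc]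
      _ ≤ 6 * v * (K * Real.log (1 + R)) := by gcongr
      _ ≤ 6 * v * (K * (2 * Real.log R)) := by gcongr
      _ = 6 * v * (K * 2) * Real.log R := by ring
end
end

section
/- Let n ≥ 3 be an integer, D > 1 and ρ > 0. Then, as δ → 0⁺, ∫_{C(0,ρ)} U_{δ,0}(x)^{2n/(n−2)} dx = ∫_{ℝⁿ₊} U₁(y)^{2n/(n−2)} dy + O(δⁿ); in particular the integral ∫_{ℝⁿ₊} U₁^{2n/(n−2)} over the half-space is finite. -/
open MeasureTheory Real Set Filter Asymptotics Topology

noncomputable section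

lemma alphaN_nonneg {n : ℕ} (hn : 1 ≤ n) : 0 ≤ alphaN n := by
  have : (1:ℝ) ≤ n := by exact_mod_cast hn
  exact rpow_nonneg (mul_nonneg (by positivity) (by linarith)) _

lemma norm_sq_add_le_bubble_denom {E : Type*} [SeminormedAddCommGroup E] {D δ : ℝ} (hD : 1 < D)
    (hδ : 0 < δ) {x : E × ℝ} (hx : 0 < x.2) :
    ‖x.1‖ ^ 2 + x.2 ^ 2 + δ ^ 2 * (D ^ 2 - 1) ≤ ‖x.1‖ ^ 2 + (x.2 + δ * D) ^ 2 - δ ^ 2 := by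
  have : 0 < x.2 * (δ * D) := by positivity
  nlinarith

lemma bubble_denom_pos {E : Type*} [SeminormedAddCommGroup E] {D δ : ℝ} (hD : 1 < D)
    (hδ : 0 < δ) {x : E × ℝ} (hx : 0 < x.2) :
    0 < ‖x.1‖ ^ 2 + (x.2 + δ * D) ^ 2 - δ ^ 2 := by
  have h : 0 < D ^ 2 - 1 := by nlinarith
  have : 0 < ‖x.1‖ ^ 2 + x.2 ^ 2 + δ ^ 2 * (D ^ 2 - 1) := by positivity
  exact this.trans_le (norm_sq_add_le_bubble_denom hD hδ hx)

/-- The critical power of the bubble in closed form. -/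
lemma bubble_rpow_critical {n : ℕ} (hn : 3 ≤ n) {D δ : ℝ} (hD : 1 < D) (hδ : 0 < δ)
    {x : EuclideanSpace ℝ (Fin (n-1)) × ℝ} (hx : 0 < x.2) :
    bubble n D δ 0 x ^ ((2*(n:ℝ))/((n:ℝ)-2)) =
      alphaN n ^ ((2*(n:ℝ))/((n:ℝ)-2)) *
        (δ ^ n / (‖x.1‖ ^ 2 + (x.2 + δ * D) ^ 2 - δ ^ 2) ^ n) := by
  have hQ := bubble_denom_pos hD hδ hx
  have hn' : (3:ℝ) ≤ n := by exact_mod_cast hn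
  have hp : ((n:ℝ)-2)/2 * ((2*(n:ℝ))/((n:ℝ)-2)) = n := by
    have : (n:ℝ) - 2 ≠ 0 := by linarith
    field_simp
  have hα := alphaN_nonneg (n := n) (by omega)
  rw [bubble, sub_zero, div_rpow (by positivity) (by positivity),
    mul_rpow hα (by positivity), ← rpow_mul hδ.le, ← rpow_mul hQ.le, hp, rpow_natCast,
    rpow_natCast, mul_div_assoc]

/-- The sup norm of a product is controlled by the Euclidean one. -/
lemma norm_prod_sq_le {E : Type*} [SeminormedAddCommGroup E] (x : E × ℝ) :
    ‖x‖ ^ 2 ≤ ‖x.1‖ ^ 2 + x.2 ^ 2 := by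
  rw [Prod.norm_def]
  rcases max_choice ‖x.1‖ ‖x.2‖ with h | h <;> rw [h]
  · nlinarith [sq_nonneg x.2]
  · rw [Real.norm_eq_abs, sq_abs]; nlinarith [sq_nonneg ‖x.1‖]

/-- The reciprocal of the `n`-th power of a function with quadratic growth is integrable in
dimension less than `2n`. -/
lemma integrableOn_div_pow_of_quadratic_growth {E : Type*} [NormedAddCommGroup E]
    [NormedSpace ℝ E] [FiniteDimensional ℝ E] [MeasurableSpace E] [BorelSpace E] {μ : Measure E}
    [μ.IsAddHaarMeasure] {n : ℕ} (hn : Module.finrank ℝ E < 2 * n) {S : Set E}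
    (hS : MeasurableSet S) {Q : E → ℝ} (hQ : Continuous Q) (a : ℝ) {k : ℝ} (hk : 0 < k)
    (h : ∀ x ∈ S, k * (1 + ‖x‖) ^ 2 ≤ Q x) :
    IntegrableOn (fun x => a / Q x ^ n) S μ := by
  have hdom : Integrable (fun x : E => |a| / k ^ n * (1 + ‖x‖) ^ (-((2 * n : ℕ) : ℝ))) μ :=
    (integrable_one_add_norm (by exact_mod_cast hn)).const_mul _
  refine hdom.integrableOn.mono' ?_ ?_
  · exact (measurable_const.div (hQ.measurable.pow_const n)).aestronglyMeasurable
  · refine (ae_restrict_iff' hS).2 (Eventually.of_forall fun x hx => ?_)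
    have hpos : 0 < k * (1 + ‖x‖) ^ 2 := by positivity
    have hle := h x hx
    rw [norm_div, norm_pow, Real.norm_eq_abs, Real.norm_eq_abs,
      abs_of_pos (hpos.trans_le hle), rpow_neg (by positivity), rpow_natCast, ← div_eq_mul_inv,
      div_div, pow_mul, ← mul_pow]
    gcongr

lemma measurableSet_halfSpace {E : Type*} [MeasurableSpace E] :
    MeasurableSet {x : E × ℝ | 0 < x.2} :=
  measurableSet_lt measurable_const measurable_snd

lemma measurableSet_cylinder {E : Type*} [NormedAddCommGroup E] [MeasurableSpace E]
    [BorelSpace E] (ρ : ℝ) :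
    MeasurableSet {x : E × ℝ | ‖x.1‖ < ρ ∧ 0 < x.2 ∧ x.2 < ρ} :=
  (measurableSet_lt measurable_fst.norm measurable_const).inter
    (measurableSet_halfSpace.inter (measurableSet_lt measurable_snd measurable_const))

lemma finrank_euclideanSpace_prod_real {n : ℕ} (hn : 1 ≤ n) :
    Module.finrank ℝ (EuclideanSpace ℝ (Fin (n-1)) × ℝ) = n := by
  rw [Module.finrank_prod, finrank_euclideanSpace_fin, Module.finrank_self]
  omega

instance isAddHaarMeasure_volume_prod_real (m : ℕ) :
    (volume : Measure (EuclideanSpace ℝ (Fin m) × ℝ)).IsAddHaarMeasure :=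
  Measure.prod.instIsAddHaarMeasure volume volume

lemma integrableOn_bubble_rpow_critical {n : ℕ} (hn : 3 ≤ n) {D δ : ℝ} (hD : 1 < D)
    (hδ : 0 < δ) :
    IntegrableOn (fun y => bubble n D δ 0 y ^ ((2*(n:ℝ))/((n:ℝ)-2)))
      {y : EuclideanSpace ℝ (Fin (n-1)) × ℝ | 0 < y.2} := by
  have hm : 0 < δ ^ 2 * (D ^ 2 - 1) := mul_pos (by positivity) (by nlinarith)
  set m := min 1 (δ ^ 2 * (D ^ 2 - 1))
  have hm0 : 0 < m := lt_min one_pos hm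
  have hm1 : m ≤ 1 := min_le_left _ _
  have hm2 : m ≤ δ ^ 2 * (D ^ 2 - 1) := min_le_right _ _
  have hint := integrableOn_div_pow_of_quadratic_growth (n := n)
    (E := EuclideanSpace ℝ (Fin (n-1)) × ℝ) (μ := volume)
    (by rw [finrank_euclideanSpace_prod_real] <;> omega) measurableSet_halfSpace
    (Q := fun x => ‖x.1‖ ^ 2 + (x.2 + δ * D) ^ 2 - δ ^ 2) (by fun_prop) (δ ^ n)
    (k := m / 2) (by positivity) (fun x hx => by
      refine le_trans ?_ (norm_sq_add_le_bubble_denom hD hδ hx)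
      nlinarith [norm_prod_sq_le x, mul_nonneg hm0.le (sq_nonneg (‖x‖ - 1)),
        mul_nonneg (sub_nonneg.2 hm1) (sq_nonneg ‖x‖)])
  exact IntegrableOn.congr_fun (hint.const_mul (alphaN n ^ ((2*(n:ℝ))/((n:ℝ)-2))))
    (fun x hx => (bubble_rpow_critical hn hD hδ hx).symm) measurableSet_halfSpace

open scoped Pointwise in
/-- Scale invariance of the critical integral of the bubble over the half-space. -/
lemma setIntegral_bubble_rpow_critical_eq {n : ℕ} (hn : 3 ≤ n) {D δ : ℝ} (hD : 1 < D)
    (hδ : 0 < δ) :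
    ∫ y in {y : EuclideanSpace ℝ (Fin (n-1)) × ℝ | 0 < y.2},
        bubble n D δ 0 y ^ ((2*(n:ℝ))/((n:ℝ)-2)) =
      ∫ y in {y : EuclideanSpace ℝ (Fin (n-1)) × ℝ | 0 < y.2},
        bubble n D 1 0 y ^ ((2*(n:ℝ))/((n:ℝ)-2)) := by
  have hH : δ • {y : EuclideanSpace ℝ (Fin (n-1)) × ℝ | 0 < y.2} = {y | 0 < y.2} := by
    ext y
    rw [mem_smul_set_iff_inv_smul_mem₀ hδ.ne']
    simp [hδ]
  have hscale := Measure.setIntegral_comp_smul_of_pos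
    (volume : Measure (EuclideanSpace ℝ (Fin (n-1)) × ℝ))
    (fun y => bubble n D δ 0 y ^ ((2*(n:ℝ))/((n:ℝ)-2))) {y | 0 < y.2} hδ
  rw [hH, finrank_euclideanSpace_prod_real (by omega), smul_eq_mul,
    eq_inv_mul_iff_mul_eq₀ (by positivity), ← integral_const_mul] at hscale
  rw [← hscale]
  refine setIntegral_congr_fun measurableSet_halfSpace fun y hy => ?_
  have hy' : 0 < (δ • y).2 := mul_pos hδ hy
  have hQ := bubble_denom_pos hD one_pos hy
  rw [bubble_rpow_critical hn hD hδ hy', bubble_rpow_critical hn hD one_pos hy]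
  have hden : ‖(δ • y).1‖ ^ 2 + ((δ • y).2 + δ * D) ^ 2 - δ ^ 2 =
      δ ^ 2 * (‖y.1‖ ^ 2 + (y.2 + 1 * D) ^ 2 - 1 ^ 2) := by
    rw [Prod.smul_fst, Prod.smul_snd, norm_smul, Real.norm_of_nonneg hδ.le, smul_eq_mul]
    ring
  rw [hden, mul_pow, ← pow_mul, mul_comm 2 n, pow_mul]
  field_simp
  simp

theorem stmt_17 (n : ℕ) (hn : 3 ≤ n) (D ρ : ℝ) (hD : 1 < D) (hρ : 0 < ρ) :
    IntegrableOn (fun y => (bubble n D 1 0 y) ^ ((2*(n:ℝ))/((n:ℝ)-2)))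
      {y : EuclideanSpace ℝ (Fin (n-1)) × ℝ | 0 < y.2} volume ∧
    (fun δ : ℝ =>
      (∫ x in {p : EuclideanSpace ℝ (Fin (n-1)) × ℝ | ‖p.1‖ < ρ ∧ 0 < p.2 ∧ p.2 < ρ},
          (bubble n D δ 0 x) ^ ((2*(n:ℝ))/((n:ℝ)-2)))
        - ∫ y in {y : EuclideanSpace ℝ (Fin (n-1)) × ℝ | 0 < y.2},
            (bubble n D 1 0 y) ^ ((2*(n:ℝ))/((n:ℝ)-2)))
      =O[𝓝[>] (0:ℝ)] (fun δ : ℝ => δ^(n:ℕ)) := by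
  refine ⟨integrableOn_bubble_rpow_critical hn hD one_pos, ?_⟩
  set H := {y : EuclideanSpace ℝ (Fin (n-1)) × ℝ | 0 < y.2}
  set C := {p : EuclideanSpace ℝ (Fin (n-1)) × ℝ | ‖p.1‖ < ρ ∧ 0 < p.2 ∧ p.2 < ρ}
  have hCm : MeasurableSet C := measurableSet_cylinder ρ
  have hm : MeasurableSet (H \ C) := measurableSet_halfSpace.diff hCm
  have hfar : ∀ x ∈ H \ C, ρ ≤ ‖x‖ := by
    rintro x ⟨hx, hxC⟩
    by_contra! hlt
    rw [Prod.norm_def, max_lt_iff] at hlt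
    exact hxC ⟨hlt.1, hx, (le_abs_self _).trans_lt hlt.2⟩
  set A := alphaN n ^ ((2*(n:ℝ))/((n:ℝ)-2))
  have hA : 0 ≤ A := rpow_nonneg (alphaN_nonneg (by omega)) _
  have hdom : IntegrableOn (fun x => A / (‖x.1‖ ^ 2 + x.2 ^ 2) ^ n) (H \ C) := by
    refine integrableOn_div_pow_of_quadratic_growth
      (by rw [finrank_euclideanSpace_prod_real] <;> omega) hm (by fun_prop) A
      (k := (ρ / (1 + ρ)) ^ 2) (by positivity) fun x hx => ?_
    refine le_trans ?_ (norm_prod_sq_le x)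
    rw [← mul_pow]
    gcongr
    rw [div_mul_eq_mul_div, div_le_iff₀ (by positivity)]
    nlinarith [hfar x hx]
  refine IsBigO.of_bound (∫ x in H \ C, A / (‖x.1‖ ^ 2 + x.2 ^ 2) ^ n) ?_
  filter_upwards [self_mem_nhdsWithin] with δ (hδ : 0 < δ)
  have hint := integrableOn_bubble_rpow_critical hn hD hδ
  rw [← setIntegral_bubble_rpow_critical_eq hn hD hδ, norm_sub_rev,
    ← setIntegral_sdiff hCm hint (fun x hx => hx.2.1), norm_pow, Real.norm_of_nonneg hδ.le,
    ← integral_mul_const]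
  refine norm_integral_le_of_norm_le (hdom.mul_const _) ?_
  refine (ae_restrict_iff' hm).2 (Eventually.of_forall fun x hx => ?_)
  have hxH : 0 < x.2 := hx.1
  have hD' : 0 ≤ δ ^ 2 * (D ^ 2 - 1) := mul_nonneg (by positivity) (by nlinarith)
  have hQ := norm_sq_add_le_bubble_denom hD hδ hxH
  have hQpos := bubble_denom_pos hD hδ hxH
  rw [bubble_rpow_critical hn hD hδ hxH, Real.norm_of_nonneg (by positivity),
    ← mul_div_assoc, div_mul_eq_mul_div]
  gcongr
  linarith
end
end

section
/- Let n ≥ 3 be an integer and D > 1. Then there exists a constant C > 0 such that for every R ≥ 2, ∫_{A(0,R)} ( U₁(y)/|y|² + |∇U₁(y)|/|y| )^{2n/(n+2)} dy ≤ C R^{−n(n−2)/(n+2)}, where A(0,R) = C(0,R) \ C(0,R/2). -/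
open MeasureTheory Real Set

noncomputable section

/-- The squared norm of the Euclidean gradient,
`|∇u(x)|² = Σᵢ (∂u/∂xᵢ)² + (∂u/∂xₙ)²`, on `ℝ^{n-1} × ℝ`. -/
def gradSq {m : ℕ} (u : EuclideanSpace ℝ (Fin m) × ℝ → ℝ)
    (x : EuclideanSpace ℝ (Fin m) × ℝ) : ℝ :=
  (∑ i : Fin m, (fderiv ℝ u x (EuclideanSpace.single i 1, 0))^2)
  + (fderiv ℝ u x ((0 : EuclideanSpace ℝ (Fin m)), (1:ℝ)))^2

/-- The cylinder `C(0,ρ) = {(ȳ, yₙ) : |ȳ| < ρ, 0 < yₙ < ρ}`. -/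
def cyl (n : ℕ) (ρ : ℝ) : Set (EuclideanSpace ℝ (Fin (n-1)) × ℝ) :=
  {y | ‖y.1‖ < ρ ∧ 0 < y.2 ∧ y.2 < ρ}

/-- The base of the power in the denominator of `bubble n D 1 0`. -/
def bubbleBase {m : ℕ} (D : ℝ) (y : EuclideanSpace ℝ (Fin m) × ℝ) : ℝ :=
  ‖y.1‖ ^ 2 + (y.2 + D) ^ 2 - 1

theorem hasFDerivAt_bubbleBase {m : ℕ} (D : ℝ) (y : EuclideanSpace ℝ (Fin m) × ℝ) :
    HasFDerivAt (bubbleBase D)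
      ((2 : ℝ) • ((innerSL ℝ y.1).comp (ContinuousLinearMap.fst ℝ (EuclideanSpace ℝ (Fin m)) ℝ)
        + (y.2 + D) • ContinuousLinearMap.snd ℝ (EuclideanSpace ℝ (Fin m)) ℝ)) y := by
  have h1 : HasFDerivAt (fun z : EuclideanSpace ℝ (Fin m) × ℝ => ‖z.1‖ ^ 2)
      _ y := (hasFDerivAt_fst (𝕜 := ℝ) (p := y)).norm_sq
  have h2 : HasFDerivAt (fun z : EuclideanSpace ℝ (Fin m) × ℝ => (z.2 + D) ^ 2)
      _ y := ((hasFDerivAt_snd (𝕜 := ℝ) (p := y)).add_const D).pow 2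
  refine ((h1.add h2).sub_const 1).congr_fderiv ?_
  ext v
  · simp
  · simp
    ring

theorem bubble_eq (n : ℕ) (D : ℝ) (y : EuclideanSpace ℝ (Fin (n - 1)) × ℝ)
    (hy : 0 < bubbleBase D y) :
    bubble n D 1 0 y = alphaN n * bubbleBase D y ^ (-(((n : ℝ) - 2) / 2)) := by
  rw [Real.rpow_neg hy.le]
  simp [bubble, bubbleBase, div_eq_mul_inv]

theorem gradSq_bubble (n : ℕ) (D : ℝ) (y : EuclideanSpace ℝ (Fin (n - 1)) × ℝ)
    (hy : 0 < bubbleBase D y) :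
    gradSq (bubble n D 1 0) y =
      (alphaN n * ((n : ℝ) - 2) * bubbleBase D y ^ (-((n : ℝ) / 2))) ^ 2 *
        (‖y.1‖ ^ 2 + (y.2 + D) ^ 2) := by
  have hb := hasFDerivAt_bubbleBase D y
  have hpos : ∀ᶠ z in nhds y, 0 < bubbleBase D z :=
    hb.continuousAt.eventually (lt_mem_nhds hy)
  have hU := ((hb.rpow_const (p := -(((n : ℝ) - 2) / 2)) (Or.inl hy.ne')).const_mul
    (alphaN n)).congr_of_eventuallyEq (hpos.mono fun z hz => bubble_eq n D z hz)
  rw [show -(((n : ℝ) - 2) / 2) - 1 = -((n : ℝ) / 2) by ring] at hU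
  rw [gradSq, hU.fderiv, EuclideanSpace.norm_sq_eq, mul_add, Finset.mul_sum]
  congr 1
  · refine Finset.sum_congr rfl fun i _ => ?_
    simp [EuclideanSpace.inner_single_right]
    ring
  · simp
    ring

theorem bubble_integrand_le (n : ℕ) (hn : 3 ≤ n) (D : ℝ) (hD : 1 < D) (R : ℝ) (hR : 2 ≤ R)
    (y : EuclideanSpace ℝ (Fin (n - 1)) × ℝ) (hy : y ∈ cyl n R \ cyl n (R / 2)) :
    bubble n D 1 0 y / (‖y.1‖ ^ 2 + y.2 ^ 2)
        + √(gradSq (bubble n D 1 0) y) / √(‖y.1‖ ^ 2 + y.2 ^ 2) ≤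
      alphaN n * (1 + 2 * ((n : ℝ) - 2) * (2 + D)) * 2 ^ n * R ^ (-(n : ℝ)) := by
  have hn' : (3 : ℝ) ≤ n := by exact_mod_cast hn
  have ha : 0 ≤ alphaN n := Real.rpow_nonneg (by nlinarith) _
  obtain ⟨⟨h1, h2, h3⟩, h4⟩ := hy
  have hR2 : (R / 2) ^ 2 ≤ ‖y.1‖ ^ 2 + y.2 ^ 2 := by
    by_contra! h
    refine h4 ⟨?_, h2, ?_⟩
    · exact lt_of_pow_lt_pow_left₀ 2 (by linarith) (by nlinarith)
    · exact lt_of_pow_lt_pow_left₀ 2 (by linarith) (by nlinarith [sq_nonneg ‖y.1‖])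
  have hR0 : 0 < (R / 2) ^ 2 := by positivity
  have hq : (R / 2) ^ 2 ≤ bubbleBase D y := by
    unfold bubbleBase
    nlinarith
  have hpow (t : ℝ) (ht : 0 ≤ t) : bubbleBase D y ^ (-t) ≤ ((R / 2) ^ 2) ^ (-t) :=
    Real.rpow_le_rpow_of_nonpos hR0 hq (by linarith)
  have hq0 := hR0.trans_le hq
  have hsq : √((R / 2) ^ 2) = R / 2 := Real.sqrt_sq (by linarith)
  have hnum : ‖y.1‖ ^ 2 + (y.2 + D) ^ 2 ≤ ((2 + D) * R) ^ 2 := by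
    have : y.2 + D ≤ (1 + D) * R := by nlinarith
    have h5 : (y.2 + D) ^ 2 ≤ ((1 + D) * R) ^ 2 := by gcongr
    have h6 : ‖y.1‖ ^ 2 ≤ R ^ 2 := by gcongr
    nlinarith [mul_pos (show 0 < 1 + D by linarith) (show 0 < R ^ 2 by positivity)]
  set P : ℝ := ((R / 2) ^ 2) ^ (-((n : ℝ) / 2)) with hP
  have hPeq : P = 2 ^ n * R ^ (-(n : ℝ)) := by
    rw [hP, ← Real.rpow_natCast (R / 2) 2, ← Real.rpow_mul (by linarith),
      Real.div_rpow (by linarith) (by norm_num)]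
    rw [show ((2 : ℕ) : ℝ) * (-((n : ℝ) / 2)) = -n by push_cast; ring,
      Real.rpow_neg zero_le_two, Real.rpow_natCast, div_inv_eq_mul, mul_comm]
  have hfirst : bubble n D 1 0 y / (‖y.1‖ ^ 2 + y.2 ^ 2) ≤ alphaN n * P := by
    have h7 : ((R / 2) ^ 2) ^ (-(((n : ℝ) - 2) / 2)) = P * (R / 2) ^ 2 := by
      rw [hP, ← Real.rpow_add_one hR0.ne']
      congr 1
      ring
    rw [bubble_eq n D y hq0]
    have h8 := hpow (((n : ℝ) - 2) / 2) (by linarith)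
    calc _ ≤ alphaN n * ((R / 2) ^ 2) ^ (-(((n : ℝ) - 2) / 2)) / (R / 2) ^ 2 := by
          gcongr
      _ = alphaN n * P := by
          rw [h7]
          field_simp
  have hsecond : √(gradSq (bubble n D 1 0) y) / √(‖y.1‖ ^ 2 + y.2 ^ 2) ≤
      alphaN n * (2 * ((n : ℝ) - 2) * (2 + D)) * P := by
    have h8 : (0 : ℝ) ≤ n - 2 := by linarith
    rw [gradSq_bubble n D y hq0, Real.sqrt_mul (sq_nonneg _),
      Real.sqrt_sq (mul_nonneg (mul_nonneg ha h8) (Real.rpow_nonneg hq0.le _))]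
    calc _ ≤ alphaN n * ((n : ℝ) - 2) * P * ((2 + D) * R) / √((R / 2) ^ 2) := by
          have h9 : √(‖y.1‖ ^ 2 + (y.2 + D) ^ 2) ≤ (2 + D) * R :=
            Real.sqrt_le_iff.2 ⟨by positivity, hnum⟩
          gcongr
          exact hpow _ (by linarith)
      _ = alphaN n * (2 * ((n : ℝ) - 2) * (2 + D)) * P := by
          rw [hsq]
          field_simp
  rw [mul_assoc, ← hPeq]
  linarith

theorem volume_cyl_diff_le (n : ℕ) (hn : 3 ≤ n) (R r : ℝ) (hR : 0 < R) :
    volume (cyl n R \ cyl n r) < ⊤ ∧ volume.real (cyl n R \ cyl n r) ≤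
      volume.real (Metric.ball (0 : EuclideanSpace ℝ (Fin (n - 1))) 1) * R ^ n := by
  have hsub : cyl n R \ cyl n r ⊆
      Metric.ball (0 : EuclideanSpace ℝ (Fin (n - 1))) R ×ˢ Ioo 0 R := by
    rintro y ⟨⟨h1, h2⟩, -⟩
    exact ⟨by simpa using h1, h2⟩
  have hfin : volume (Metric.ball (0 : EuclideanSpace ℝ (Fin (n - 1))) R ×ˢ Ioo 0 R) < ⊤ := by
    rw [Measure.volume_eq_prod, Measure.prod_prod]
    exact ENNReal.mul_lt_top measure_ball_lt_top measure_Ioo_lt_top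
  refine ⟨(measure_mono hsub).trans_lt hfin, (measureReal_mono hsub hfin.ne).trans_eq ?_⟩
  rw [Measure.volume_eq_prod, measureReal_prod_prod, measureReal_def, Measure.addHaar_ball_of_pos _ _ hR,
    ENNReal.toReal_mul, ENNReal.toReal_ofReal (by positivity), ← measureReal_def,
    Real.volume_real_Ioo_of_le hR.le, finrank_euclideanSpace_fin, sub_zero, mul_right_comm,
    ← pow_succ, Nat.sub_add_cancel (by omega), mul_comm]

theorem stmt_19 (n : ℕ) (hn : 3 ≤ n) (D : ℝ) (hD : 1 < D) :
    ∃ C : ℝ, 0 < C ∧ ∀ R : ℝ, 2 ≤ R →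
      (∫ y in cyl n R \ cyl n (R/2),
          (bubble n D 1 0 y / (‖y.1‖^2 + y.2^2)
            + Real.sqrt (gradSq (bubble n D 1 0) y) / Real.sqrt (‖y.1‖^2 + y.2^2))
            ^ ((2*(n:ℝ))/((n:ℝ)+2)))
        ≤ C * R ^ (-((n:ℝ)*((n:ℝ)-2))/((n:ℝ)+2)) := by
  have hn' : (3 : ℝ) ≤ n := by exact_mod_cast hn
  have ha : 0 < alphaN n := Real.rpow_pos_of_pos (by nlinarith) _
  set K : ℝ := alphaN n * (1 + 2 * ((n : ℝ) - 2) * (2 + D)) * 2 ^ n with hK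
  have hK0 : 0 < K := by
    have : 0 < (n : ℝ) - 2 := by linarith
    positivity
  set p : ℝ := 2 * (n : ℝ) / ((n : ℝ) + 2) with hp
  have hp0 : 0 ≤ p := by positivity
  set v : ℝ := volume.real (Metric.ball (0 : EuclideanSpace ℝ (Fin (n - 1))) 1) with hv
  have hv0 : 0 < v := ENNReal.toReal_pos (Metric.measure_ball_pos _ _ one_pos).ne'
    measure_ball_lt_top.ne
  refine ⟨K ^ p * v, by positivity, fun R hR => ?_⟩
  have hR0 : 0 < R := by linarith
  obtain ⟨hfin, hvol⟩ := volume_cyl_diff_le n hn R (R / 2) hR0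
  calc _ ≤ (K * R ^ (-(n : ℝ))) ^ p * volume.real (cyl n R \ cyl n (R / 2)) := by
        refine (Real.le_norm_self _).trans (norm_setIntegral_le_of_norm_le_const hfin fun y hy => ?_)
        have hb : 0 ≤ bubble n D 1 0 y := by
          have h2 := hy.1.2.1
          unfold bubble
          refine div_nonneg (by positivity) (Real.rpow_nonneg ?_ _)
          nlinarith [sq_nonneg ‖y.1 - 0‖]
        rw [Real.norm_of_nonneg (by positivity)]
        gcongr
        exact bubble_integrand_le n hn D hD R hR y hy
    _ ≤ (K * R ^ (-(n : ℝ))) ^ p * (v * R ^ n) := by gcongr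
    _ = K ^ p * v * R ^ (-((n : ℝ) * ((n : ℝ) - 2)) / ((n : ℝ) + 2)) := by
        rw [Real.mul_rpow hK0.le (by positivity), ← Real.rpow_mul hR0.le,
          show -((n : ℝ) * ((n : ℝ) - 2)) / ((n : ℝ) + 2) = -(n : ℝ) * p + n by
            rw [hp]; field_simp; ring,
          Real.rpow_add hR0, Real.rpow_natCast]
        ring
end
end
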